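/- Let ω : ℤ → ℝ be an environment with ω(x) ∈ [1/2,1) for all x, which is periodic with period N ≥ 1 (ω(x+N) = ω(x) for all x). Suppose that some random walk X in the 'have your cookie and eat it' environment ω with X_0 = 1 almost surely satisfies P(T_0 = ∞) > 0. Then every random walk Y in the 'have your cookie and eat it' environment ω (on any probability space) with Y_0 = y almost surely for some y ∈ ℤ satisfies lim_{n→∞} Y_n = +∞ almost surely; in particular the process is transient. -/

import Mathlib

open MeasureTheory Filter

noncomputable section

/-- The hitting time of site `x` by the process `X`, with value `⊤` if `x` is never hit. -/
def hitTime {Ω : Type*} (X : ℕ → Ω → ℤ) (x : ℤ) (ω : Ω) : ℕ∞ :=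
  ⨅ (n : ℕ) (_ : X n ω = x), (n : ℕ∞)

/-- The natural filtration of the process `X` at time `n`. -/
def natSA {Ω : Type*} (X : ℕ → Ω → ℤ) (n : ℕ) : MeasurableSpace Ω :=
  ⨆ m ∈ Finset.range (n + 1), MeasurableSpace.comap (X m) ⊤

/-- The event `A_n` that before time `n` the walk has never jumped leftward from its
current site `X_n`. -/
def freshEvent {Ω : Type*} (X : ℕ → Ω → ℤ) (n : ℕ) : Set Ω :=
  {ω | ∀ m < n, ¬(X m ω = X n ω ∧ X (m + 1) ω = X m ω - 1)}

/-- A random walk in the "have your cookie and eat it" environment `env`. -/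
structure IsCookieRW {Ω : Type*} [MeasurableSpace Ω] (P : Measure Ω)
    (env : ℤ → ℝ) (X : ℕ → Ω → ℤ) : Prop where
  envRange : ∀ x : ℤ, env x ∈ Set.Ico (1 / 2 : ℝ) 1
  meas : ∀ n, Measurable (X n)
  steps : ∀ n : ℕ, ∀ᵐ ω ∂P, |X (n + 1) ω - X n ω| = 1
  cond : ∀ n : ℕ,
    (P[Set.indicator {ω | X (n + 1) ω = X n ω + 1} (fun _ => (1 : ℝ)) | natSA X n])
      =ᵐ[P]
    fun ω => env (X n ω) * Set.indicator (freshEvent X n) (fun _ => (1 : ℝ)) ω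
      + (1 / 2) * Set.indicator (freshEvent X n)ᶜ (fun _ => (1 : ℝ)) ω

section Deterministic

/-- The probability of a jump to the right from `x` when `S` is the set of sites from which the
walk has already jumped to the left. -/
def rightProb (env : ℤ → ℝ) (x : ℤ) (S : Finset ℤ) : ℝ :=
  if x ∈ S then 1 / 2 else env x

/-- The probability that a cookie random walk at `x`, which has already jumped to the left from
the sites in `S`, stays in `[b, ∞)` for the next `m` steps. -/
def stayProb (env : ℤ → ℝ) (b : ℤ) : ℕ → ℤ → Finset ℤ → ℝ
  | 0, x, _ => if b ≤ x then 1 else 0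
  | m + 1, x, S =>
    if b ≤ x then
      rightProb env x S * stayProb env b m (x + 1) S
        + (1 - rightProb env x S) * stayProb env b m (x - 1) (insert x S)
    else 0

variable {env : ℤ → ℝ}

theorem rightProb_mem (henv : ∀ x : ℤ, env x ∈ Set.Ico (1 / 2 : ℝ) 1) (x : ℤ) (S : Finset ℤ) :
    rightProb env x S ∈ Set.Ico (1 / 2 : ℝ) 1 := by
  unfold rightProb
  split_ifs
  · norm_num
  · exact henv x

theorem stayProb_mem_Icc (henv : ∀ x : ℤ, env x ∈ Set.Ico (1 / 2 : ℝ) 1) (b : ℤ) (m : ℕ) :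
    ∀ (x : ℤ) (S : Finset ℤ), stayProb env b m x S ∈ Set.Icc (0 : ℝ) 1 := by
  induction m with
  | zero => intro x S; simp only [stayProb]; split_ifs <;> simp
  | succ m ih =>
    intro x S
    simp only [stayProb]
    split_ifs
    · have hp := rightProb_mem henv x S
      have h₁ := ih (x + 1) S
      have h₂ := ih (x - 1) (insert x S)
      simp only [Set.mem_Ico, Set.mem_Icc] at *
      constructor
      · exact add_nonneg (mul_nonneg (by linarith) h₁.1) (mul_nonneg (by linarith) h₂.1)
      · nlinarith
    · simp

theorem norm_stayProb_le (henv : ∀ x : ℤ, env x ∈ Set.Ico (1 / 2 : ℝ) 1) (b : ℤ) (m : ℕ)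
    (x : ℤ) (S : Finset ℤ) : ‖stayProb env b m x S‖ ≤ 1 := by
  have h := stayProb_mem_Icc henv b m x S
  rw [Real.norm_eq_abs, abs_of_nonneg h.1]
  exact h.2

/-- `stayProb` only depends on the environment and on the used cookies in `[b, ∞)`, and is
invariant under translations. -/
theorem stayProb_add (b c : ℤ) (hc : ∀ z, env (z + c) = env z) (m : ℕ) :
    ∀ (x : ℤ) (S S' : Finset ℤ), (∀ z, b ≤ z → (z + c ∈ S ↔ z ∈ S')) →
      stayProb env (b + c) m (x + c) S = stayProb env b m x S' := by
  induction m with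
  | zero => intro x S S' _; simp [stayProb]
  | succ m ih =>
    intro x S S' hS
    simp only [stayProb, add_le_add_iff_right]
    split_ifs with hx
    · have hp : rightProb env (x + c) S = rightProb env x S' := by
        simp only [rightProb, hS x hx, hc]
      have h₁ : stayProb env (b + c) m (x + c + 1) S = stayProb env b m (x + 1) S' := by
        rw [add_right_comm]; exact ih _ _ _ hS
      have h₂ : stayProb env (b + c) m (x + c - 1) (insert (x + c) S)
          = stayProb env b m (x - 1) (insert x S') := by
        rw [add_sub_right_comm]
        refine ih _ _ _ fun z hz => ?_
        simp [hS z hz]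
      rw [hp, h₁, h₂]
    · rfl

theorem env_add_mul {N : ℕ} (hper : ∀ x : ℤ, env (x + N) = env x) (j : ℤ) (x : ℤ) :
    env (x + j * N) = env x :=
  Function.Periodic.int_mul (f := env) (c := (N : ℤ)) hper j x

end Deterministic

section Filtration

theorem measurable_natSA {Ω : Type*} {X : ℕ → Ω → ℤ} {m n : ℕ} (hmn : m ≤ n) :
    Measurable[natSA X n] (X m) :=
  Measurable.of_comap_le (le_iSup₂_of_le m (Finset.mem_range.2 (Nat.lt_succ_of_le hmn)) le_rfl)

variable {Ω : Type*} [MeasurableSpace Ω] {X : ℕ → Ω → ℤ}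

/-- The σ-algebras `natSA X n`, bundled as a filtration. -/
def natFiltration (hX : ∀ n, Measurable (X n)) : Filtration ℕ ‹MeasurableSpace Ω› where
  seq := natSA X
  mono' _ _ hmn := biSup_mono fun _ hk =>
    Finset.mem_range.2 ((Finset.mem_range.1 hk).trans_le (Nat.succ_le_succ hmn))
  le' _ := iSup₂_le fun k _ => (hX k).comap_le

theorem natSA_le (hX : ∀ n, Measurable (X n)) (n : ℕ) : natSA X n ≤ ‹MeasurableSpace Ω› :=
  (natFiltration hX).le n

end Filtration

section UsedSites

variable {Ω : Type*} (X : ℕ → Ω → ℤ)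

/-- The set of sites from which the walk has jumped to the left before time `n`. -/
def usedSites : ℕ → Ω → Finset ℤ
  | 0, _ => ∅
  | n + 1, ω => if X (n + 1) ω = X n ω - 1 then insert (X n ω) (usedSites n ω) else usedSites n ω

theorem mem_usedSites (n : ℕ) (ω : Ω) (x : ℤ) :
    x ∈ usedSites X n ω ↔ ∃ m < n, X m ω = x ∧ X (m + 1) ω = X m ω - 1 := by
  induction n with
  | zero => simp [usedSites]
  | succ n ih =>
    have key : (∃ m < n + 1, X m ω = x ∧ X (m + 1) ω = X m ω - 1) ↔
        (X n ω = x ∧ X (n + 1) ω = X n ω - 1) ∨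
          ∃ m < n, X m ω = x ∧ X (m + 1) ω = X m ω - 1 := by
      simp only [Nat.lt_succ_iff_lt_or_eq, or_and_right, exists_or, exists_eq_left]
      exact or_comm
    rw [key, ← ih, usedSites]
    split_ifs with h
    · simp [h, eq_comm]
    · simp [h]

theorem mem_freshEvent_iff (n : ℕ) (ω : Ω) :
    ω ∈ freshEvent X n ↔ X n ω ∉ usedSites X n ω := by
  simp [freshEvent, mem_usedSites]

theorem measurable_usedSites (n : ℕ) : Measurable[natSA X n] (usedSites X n) := by
  induction n with
  | zero => exact measurable_const
  | succ n ih =>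
    have hn : natSA X n ≤ natSA X (n + 1) := biSup_mono fun _ hk =>
      Finset.mem_range.2 ((Finset.mem_range.1 hk).trans (Nat.lt_succ_self _))
    have h : Measurable[natSA X (n + 1)] fun ω => (X (n + 1) ω, X n ω, usedSites X n ω) :=
      (measurable_natSA le_rfl).prodMk
        ((measurable_natSA n.le_succ).prodMk (ih.mono hn le_rfl))
    exact (Measurable.of_discrete (f := fun q : ℤ × ℤ × Finset ℤ =>
      if q.1 = q.2.1 - 1 then insert q.2.1 q.2.2 else q.2.2)).comp h

/-- Real functions of the current site and the used sites are adapted. -/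
theorem stronglyMeasurable_state (n : ℕ) (F : ℤ → Finset ℤ → ℝ) :
    StronglyMeasurable[natSA X n] fun ω => F (X n ω) (usedSites X n ω) := by
  have h : Measurable[natSA X n] fun ω => (X n ω, usedSites X n ω) :=
    (measurable_natSA le_rfl).prodMk (measurable_usedSites X n)
  exact ((Measurable.of_discrete (f := fun q : ℤ × Finset ℤ => F q.1 q.2)).comp h).stronglyMeasurable

end UsedSites

section Events

variable {Ω : Type*} (X : ℕ → Ω → ℤ)

/-- The event that the walk stays in `[b, ∞)` for `m` steps from time `n` on. -/
def stayEvent (b : ℤ) (m n : ℕ) : Set Ω :=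
  {ω | ∀ i ≤ m, b ≤ X (n + i) ω}

/-- The event that the walk stays in `[b, ∞)` from time `n` on. -/
def stayForever (b : ℤ) (n : ℕ) : Set Ω :=
  {ω | ∀ i, b ≤ X (n + i) ω}

/-- The event that the walk reaches a new strict maximum `b` at time `n`. -/
def freshMax (b : ℤ) (n : ℕ) : Set Ω :=
  {ω | X n ω = b ∧ ∀ m < n, X m ω < b}

theorem measurableSet_freshMax (b : ℤ) (n : ℕ) :
    MeasurableSet[natSA X n] (freshMax X b n) := by
  have h : freshMax X b n = X n ⁻¹' {b} ∩ ⋂ m, ⋂ (_ : m < n), X m ⁻¹' Set.Iio b := by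
    ext ω; simp [freshMax]
  rw [h]
  exact (measurable_natSA le_rfl (.of_discrete (s := {b}))).inter <| .iInter fun m => .iInter
    fun hm => measurable_natSA hm.le (.of_discrete (s := Set.Iio b))

theorem stayForever_eq_iInter (b : ℤ) (n : ℕ) :
    stayForever X b n = ⋂ m, stayEvent X b m n := by
  ext ω
  simp only [stayForever, stayEvent, Set.mem_ofPred_eq, Set.mem_iInter]
  exact ⟨fun h m i _ => h i, fun h i => h i i le_rfl⟩

theorem antitone_stayEvent (b : ℤ) (n : ℕ) :
    Antitone fun m => stayEvent X b m n :=
  fun _ _ hmk _ h i hi => h i (hi.trans hmk)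

end Events

namespace IsCookieRW

variable {Ω : Type*} [MeasurableSpace Ω] {P : Measure Ω} {env : ℤ → ℝ} {X : ℕ → Ω → ℤ}

theorem condExp_right (hX : IsCookieRW P env X) (n : ℕ) :
    P[Set.indicator {ω | X (n + 1) ω = X n ω + 1} (fun _ => (1 : ℝ)) | natSA X n]
      =ᵐ[P] fun ω => rightProb env (X n ω) (usedSites X n ω) := by
  filter_upwards [hX.cond n] with ω hω
  rw [hω]
  by_cases h : ω ∈ freshEvent X n
  · have h' := (mem_freshEvent_iff X n ω).1 h
    simp [h, h', rightProb]
  · have h' : X n ω ∈ usedSites X n ω := by rwa [mem_freshEvent_iff, not_not] at h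
    simp [h, h', rightProb]

theorem measurableSet_right (hX : IsCookieRW P env X) (n : ℕ) :
    MeasurableSet {ω | X (n + 1) ω = X n ω + 1} :=
  measurableSet_eq_fun (hX.meas _) ((hX.meas n).add_const 1)

theorem ae_right_or_left (hX : IsCookieRW P env X) :
    ∀ᵐ ω ∂P, ∀ n, X (n + 1) ω = X n ω + 1 ∨ X (n + 1) ω = X n ω - 1 := by
  filter_upwards [ae_all_iff.2 hX.steps] with ω hω n
  rcases eq_or_eq_neg_of_abs_eq (hω n) with h | h <;> omega

theorem measurableSet_stayEvent (hX : IsCookieRW P env X) (b : ℤ) (m n : ℕ) :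
    MeasurableSet (stayEvent X b m n) := by
  simp only [stayEvent, Set.ofPred_forall]
  exact .iInter fun i => .iInter fun _ => measurableSet_le measurable_const (hX.meas _)

theorem measurableSet_stayForever (hX : IsCookieRW P env X) (b : ℤ) (n : ℕ) :
    MeasurableSet (stayForever X b n) := by
  rw [stayForever_eq_iInter]
  exact .iInter fun m => hX.measurableSet_stayEvent b m n

variable [IsProbabilityMeasure P]

/-- One-step transition of a cookie random walk: the conditional expectation of a quantity equal
to `a` after a jump to the right and to `c` after a jump to the left. -/
theorem condExp_step (hX : IsCookieRW P env X) (n : ℕ) {a c f : Ω → ℝ}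
    (ha : StronglyMeasurable[natSA X n] a) (hc : StronglyMeasurable[natSA X n] c)
    (hai : Integrable a P) (hci : Integrable c P)
    (hfa : ∀ᵐ ω ∂P, X (n + 1) ω = X n ω + 1 → f ω = a ω)
    (hfc : ∀ᵐ ω ∂P, X (n + 1) ω = X n ω - 1 → f ω = c ω) :
    P[f | natSA X n] =ᵐ[P] fun ω =>
      rightProb env (X n ω) (usedSites X n ω) * a ω
        + (1 - rightProb env (X n ω) (usedSites X n ω)) * c ω := by
  set R : Ω → ℝ := Set.indicator {ω | X (n + 1) ω = X n ω + 1} (fun _ => (1 : ℝ)) with hR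
  have hRi : Integrable R P := (integrable_const 1).indicator (hX.measurableSet_right n)
  have hRm : Integrable (R * (a - c)) P := by
    have : R * (a - c) = Set.indicator {ω | X (n + 1) ω = X n ω + 1} (a - c) := by
      ext ω
      by_cases h : X (n + 1) ω = X n ω + 1 <;> simp [hR, h]
    rw [this]
    exact (hai.sub hci).indicator (hX.measurableSet_right n)
  have hf : f =ᵐ[P] R * (a - c) + c := by
    filter_upwards [hX.ae_right_or_left, hfa, hfc] with ω hω h₁ h₂
    rcases hω n with h | h
    · simp [hR, h, h₁ h]
    · have : X (n + 1) ω ≠ X n ω + 1 := by omega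
      simp [hR, this, h₂ h]
  have hcc : P[c | natSA X n] = c := condExp_of_stronglyMeasurable (natSA_le hX.meas n) hc hci
  filter_upwards [condExp_congr_ae (m := natSA X n) hf, condExp_add hRm hci (natSA X n),
    condExp_mul_of_stronglyMeasurable_right (ha.sub hc) hRm hRi, hX.condExp_right n]
    with ω h₁ h₂ h₃ h₄
  rw [h₁, h₂, Pi.add_apply, h₃, hcc, Pi.mul_apply, h₄, Pi.sub_apply]
  ring

theorem integrable_state (hX : IsCookieRW P env X) (n : ℕ) {F : ℤ → Finset ℤ → ℝ}
    (hF : ∀ x S, ‖F x S‖ ≤ 1) : Integrable (fun ω => F (X n ω) (usedSites X n ω)) P :=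
  .of_bound ((stronglyMeasurable_state X n F).mono (natSA_le hX.meas n)).aestronglyMeasurable 1
    (.of_forall fun _ => hF _ _)

theorem condExp_stayEvent (hX : IsCookieRW P env X) (b : ℤ) (m : ℕ) : ∀ n,
    P[(stayEvent X b m n).indicator (fun _ => (1 : ℝ)) | natSA X n]
      =ᵐ[P] fun ω => stayProb env b m (X n ω) (usedSites X n ω) := by
  induction m with
  | zero =>
    intro n
    have h : (stayEvent X b 0 n).indicator (fun _ => (1 : ℝ))
        = fun ω => stayProb env b 0 (X n ω) (usedSites X n ω) := by
      ext ω
      simp [stayEvent, stayProb, Set.indicator]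
    rw [h, condExp_of_stronglyMeasurable (natSA_le hX.meas n) (stronglyMeasurable_state X n _)
      (hX.integrable_state n (norm_stayProb_le hX.envRange b 0))]
  | succ m ih =>
    intro n
    have hset : (stayEvent X b (m + 1) n).indicator (fun _ => (1 : ℝ))
        = {ω | b ≤ X n ω}.indicator
            ((stayEvent X b m (n + 1)).indicator fun _ => (1 : ℝ)) := by
      rw [Set.indicator_indicator]
      congr 1
      ext ω
      simp only [stayEvent, Set.mem_ofPred_eq, Set.mem_inter_iff]
      constructor
      · refine fun h => ⟨h 0 (Nat.zero_le _), fun i hi => ?_⟩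
        rw [Nat.add_right_comm]
        exact h (i + 1) (Nat.succ_le_succ hi)
      · rintro ⟨h₀, h⟩ (_ | i) hi
        · exact h₀
        · rw [← Nat.add_assoc, Nat.add_right_comm]
          exact h i (Nat.le_of_succ_le_succ hi)
    have hint : Integrable ((stayEvent X b m (n + 1)).indicator fun _ => (1 : ℝ)) P :=
      (integrable_const 1).indicator (hX.measurableSet_stayEvent b m (n + 1))
    have hb : MeasurableSet[natSA X n] {ω | b ≤ X n ω} :=
      measurable_natSA (X := X) le_rfl (MeasurableSet.of_discrete (s := Set.Ici b))
    have htower := condExp_condExp_of_le (μ := P)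
      (f := (stayEvent X b m (n + 1)).indicator fun _ => (1 : ℝ))
      ((natFiltration hX.meas).mono n.le_succ) (natSA_le hX.meas (n + 1))
    have hF := norm_stayProb_le hX.envRange b m
    have hstep := hX.condExp_step n
      (f := fun ω => stayProb env b m (X (n + 1) ω) (usedSites X (n + 1) ω))
      (stronglyMeasurable_state X n fun x S => stayProb env b m (x + 1) S)
      (stronglyMeasurable_state X n fun x S => stayProb env b m (x - 1) (insert x S))
      (hX.integrable_state n (F := fun x S => stayProb env b m (x + 1) S) fun _ _ => hF _ _)
      (hX.integrable_state n (F := fun x S => stayProb env b m (x - 1) (insert x S))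
        fun _ _ => hF _ _)
      (.of_forall fun ω h => by
        have h' : X (n + 1) ω ≠ X n ω - 1 := by omega
        simp only [usedSites]
        rw [if_neg h', h])
      (.of_forall fun ω h => by simp [usedSites, h])
    rw [hset]
    filter_upwards [condExp_indicator hint hb, htower,
      condExp_congr_ae (m := natSA X n) (ih (n + 1)), hstep] with ω h₁ h₂ h₃ h₄
    rw [h₁]
    simp only [Set.indicator, Set.mem_ofPred_eq, stayProb]
    split_ifs
    · exact h₂.symm.trans (h₃.trans h₄)
    · rfl

/-- Started afresh at `b`, the walk stays in `[b, ∞)` with probability the limit of `stayProb`. -/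
theorem condExp_freshMax_stayForever (hX : IsCookieRW P env X) (b : ℤ) (n : ℕ) {q : ℝ}
    (hq : Tendsto (fun m => stayProb env b m b ∅) atTop (nhds q)) :
    P[(freshMax X b n ∩ stayForever X b n).indicator (fun _ => (1 : ℝ)) | natSA X n]
      =ᵐ[P] (freshMax X b n).indicator fun _ => q := by
  have hC := measurableSet_freshMax X b n
  have hC' := natSA_le hX.meas n _ hC
  have hle : ∀ m, stayProb env b m b ∅ ∈ Set.Icc (0 : ℝ) 1 :=
    fun m => stayProb_mem_Icc hX.envRange b m b ∅
  have hSi : ∀ m, Integrable ((stayEvent X b m n).indicator fun _ => (1 : ℝ)) P :=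
    fun m => (integrable_const 1).indicator (hX.measurableSet_stayEvent b m n)
  have hlim : P[(freshMax X b n ∩ stayForever X b n).indicator (fun _ => (1 : ℝ)) | natSA X n]
      =ᵐ[P] P[(freshMax X b n).indicator (fun _ => q) | natSA X n] := by
    refine tendsto_condExp_unique
      (fun m => (freshMax X b n).indicator ((stayEvent X b m n).indicator fun _ => (1 : ℝ)))
      (fun m => (freshMax X b n).indicator fun _ => stayProb env b m b ∅) _ _
      (fun m => (hSi m).indicator hC') (fun m => (integrable_const _).indicator hC')
      ?_ ?_ 1 (integrable_const 1) 1 (integrable_const 1) ?_ ?_ fun m => ?_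
    · refine .of_forall fun ω => ?_
      rw [← Set.indicator_indicator]
      have h := (antitone_stayEvent X b n).tendsto_indicator
        (fun m => stayEvent X b m n) (fun _ => (1 : ℝ)) ω
      rw [← stayForever_eq_iInter] at h
      by_cases hω : ω ∈ freshMax X b n
      · simpa only [Set.indicator_of_mem hω] using h.mono_right (pure_le_nhds _)
      · simp [hω]
    · refine .of_forall fun ω => ?_
      by_cases hω : ω ∈ freshMax X b n
      · simpa [hω] using hq
      · simp [hω]
    · refine fun m => .of_forall fun ω => ?_
      simp only [Set.indicator]
      split_ifs <;> simp
    · refine fun m => .of_forall fun ω => ?_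
      by_cases hω : ω ∈ freshMax X b n
      · simpa [hω] using norm_stayProb_le hX.envRange b m b ∅
      · simp [hω]
    · have hgs : P[(freshMax X b n).indicator (fun _ => stayProb env b m b ∅) | natSA X n]
          = (freshMax X b n).indicator fun _ => stayProb env b m b ∅ :=
        condExp_of_stronglyMeasurable (natSA_le hX.meas n)
          (stronglyMeasurable_const.indicator hC) ((integrable_const _).indicator hC')
      rw [hgs]
      filter_upwards [condExp_indicator (hSi m) hC, hX.condExp_stayEvent b m n] with ω h₁ h₂
      rw [h₁]
      by_cases hω : ω ∈ freshMax X b n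
      · rw [Set.indicator_of_mem hω, Set.indicator_of_mem hω, h₂, hω.1]
        have h := stayProb_add (env := env) b 0 (by simp) m b (usedSites X n ω) ∅ fun z hz => by
          simp only [add_zero, mem_usedSites, Finset.notMem_empty, iff_false]
          rintro ⟨k, hk, rfl, -⟩
          exact absurd (hω.2 k hk) (not_lt.2 hz)
        simpa using h
      · simp [hω]
  refine hlim.trans ?_
  rw [condExp_of_stronglyMeasurable (natSA_le hX.meas n)
    (stronglyMeasurable_const.indicator hC) ((integrable_const _).indicator hC')]

theorem tendsto_stayProb (hX : IsCookieRW P env X) {b : ℤ} (h0 : ∀ᵐ ω ∂P, X 0 ω = b) :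
    Tendsto (fun m => stayProb env b m b ∅) atTop (nhds (P.real (stayForever X b 0))) := by
  have h : ∀ m, stayProb env b m b ∅ = P.real (stayEvent X b m 0) := fun m => by
    have h₁ : ∫ ω, P[(stayEvent X b m 0).indicator (fun _ => (1 : ℝ)) | natSA X 0] ω ∂P
        = ∫ _, stayProb env b m b ∅ ∂P := by
      refine integral_congr_ae ?_
      filter_upwards [hX.condExp_stayEvent b m 0, h0] with ω hω h0ω
      rw [hω, h0ω, usedSites]
    rw [integral_condExp (natSA_le hX.meas 0),
      integral_indicator_const _ (hX.measurableSet_stayEvent b m 0)] at h₁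
    simpa using h₁.symm
  simp only [h, stayForever_eq_iInter]
  exact (ENNReal.tendsto_toReal (measure_ne_top _ _)).comp <|
    tendsto_measure_iInter_atTop
      (fun m => (hX.measurableSet_stayEvent b m 0).nullMeasurableSet)
      (antitone_stayEvent X b 0) ⟨0, measure_ne_top _ _⟩

theorem measure_stayForever_pos (hX : IsCookieRW P env X) (h0 : ∀ᵐ ω ∂P, X 0 ω = 1)
    (hhit : 0 < P {ω | hitTime X 0 ω = ⊤}) : 0 < P.real (stayForever X 1 0) := by
  refine ENNReal.toReal_pos (hhit.trans_le (measure_mono_ae ?_)).ne' (measure_ne_top _ _)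
  filter_upwards [h0, hX.ae_right_or_left] with ω h₀ hstep hhitω i
  have hne : ∀ n, X n ω ≠ 0 := by
    intro n hn
    have hle : hitTime X 0 ω ≤ n := iInf₂_le n hn
    rw [show hitTime X 0 ω = ⊤ from hhitω] at hle
    simp at hle
  rw [zero_add]
  induction i with
  | zero => exact h₀.ge
  | succ i ih =>
    have := hne (i + 1)
    rcases hstep i with h | h <;> omega

theorem integrable_coe (hX : IsCookieRW P env X) {y : ℤ} (h0 : ∀ᵐ ω ∂P, X 0 ω = y) (n : ℕ) :
    Integrable (fun ω => (X n ω : ℝ)) P := by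
  have hm : ∀ n, Measurable fun ω => (X n ω : ℝ) :=
    fun n => (Measurable.of_discrete (f := fun z : ℤ => (z : ℝ))).comp (hX.meas n)
  induction n with
  | zero =>
    refine (integrable_const (y : ℝ)).congr ?_
    filter_upwards [h0] with ω hω
    rw [hω]
  | succ n ih =>
    have hd : Integrable (fun ω => (X (n + 1) ω : ℝ) - X n ω) P := by
      refine .of_bound ((hm _).sub (hm _)).aestronglyMeasurable 1 ?_
      filter_upwards [hX.steps n] with ω hω
      rw [Real.norm_eq_abs]
      exact_mod_cast hω.le
    refine (ih.add hd).congr (.of_forall fun ω => ?_)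
    simp

theorem submartingale (hX : IsCookieRW P env X) {y : ℤ} (h0 : ∀ᵐ ω ∂P, X 0 ω = y) :
    Submartingale (fun n ω => (X n ω : ℝ)) (natFiltration hX.meas) P := by
  refine submartingale_nat (fun n => stronglyMeasurable_state X n fun x _ => (x : ℝ))
    (hX.integrable_coe h0) fun n => ?_
  have hi := hX.integrable_coe h0 n
  have h := hX.condExp_step n (f := fun ω => (X (n + 1) ω : ℝ))
    (stronglyMeasurable_state X n fun x _ => (x : ℝ) + 1)
    (stronglyMeasurable_state X n fun x _ => (x : ℝ) - 1)
    (hi.add (integrable_const 1)) (hi.sub (integrable_const 1))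
    (.of_forall fun ω h => by simp [h]) (.of_forall fun ω h => by simp [h])
  refine EventuallyLE.trans_eq (.of_forall fun ω => ?_) h.symm
  have hp := (rightProb_mem hX.envRange (X n ω) (usedSites X n ω)).1
  dsimp only
  linarith

/-- A cookie random walk is almost surely unbounded above. -/
theorem ae_exists_le (hX : IsCookieRW P env X) {y : ℤ} (h0 : ∀ᵐ ω ∂P, X 0 ω = y) :
    ∀ᵐ ω ∂P, ∀ M : ℤ, ∃ n, M ≤ X n ω := by
  have hsteps := ae_all_iff.2 hX.steps
  have hb := (hX.submartingale h0).bddAbove_iff_exists_tendsto (R := 1) <| by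
    filter_upwards [hsteps] with ω hω i
    have := (hω i).le
    push_cast
    exact_mod_cast this
  filter_upwards [hb, hsteps] with ω hω hs
  by_contra! hM
  obtain ⟨M, hM⟩ := hM
  obtain ⟨c, hc⟩ := hω.1 ⟨(M : ℝ), by rintro _ ⟨n, rfl⟩; exact Int.cast_le.2 (hM n).le⟩
  have hlim := ((hc.comp (tendsto_add_atTop_nat 1)).sub hc).abs
  have hone : (fun n => |(X (n + 1) ω : ℝ) - X n ω|) = fun _ => 1 := by
    ext n
    exact_mod_cast hs n
  simp only [Function.comp_def, sub_self, abs_zero, hone] at hlim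
  exact one_ne_zero (tendsto_nhds_unique tendsto_const_nhds hlim)

end IsCookieRW

/-- A sequence of integers that increases by at most one at each step and is unbounded above
reaches each level above its start for a first time. -/
theorem exists_first_eq {u : ℕ → ℤ} (hu : ∀ n, u (n + 1) ≤ u n + 1) (hsup : ∀ M, ∃ n, M ≤ u n)
    {b : ℤ} (hb : u 0 < b) : ∃ n, u n = b ∧ ∀ m < n, u m < b := by
  classical
  refine ⟨Nat.find (hsup b), ?_, fun m hm => not_le.1 (Nat.find_min (hsup b) hm)⟩
  have hspec := Nat.find_spec (hsup b)
  have hmin := fun m => Nat.find_min (hsup b) (m := m)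
  generalize Nat.find (hsup b) = n at *
  cases n with
  | zero => omega
  | succ n =>
    have := hmin n n.lt_succ_self
    have := hu n
    omega

/-- If a walk started afresh at any site of the form `1 + j * N` stays above it forever with
probability `q > 0`, then almost surely this happens at infinitely many new maxima. -/
theorem IsCookieRW.ae_frequently_freshMax_stayForever {Ω : Type*} [MeasurableSpace Ω]
    {P : Measure Ω} [IsProbabilityMeasure P] {env : ℤ → ℝ} {X : ℕ → Ω → ℤ}
    (hX : IsCookieRW P env X) {y : ℤ} (h0 : ∀ᵐ ω ∂P, X 0 ω = y) {N : ℕ} (hN : 1 ≤ N) {q : ℝ}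
    (hq0 : 0 < q)
    (hq : ∀ j : ℤ, Tendsto (fun m => stayProb env (1 + j * N) m (1 + j * N) ∅) atTop (nhds q)) :
    ∀ᵐ ω ∂P, ∀ k : ℕ, ∃ n ≥ k, ∃ j : ℤ,
      ω ∈ freshMax X (1 + j * N) n ∩ stayForever X (1 + j * N) n := by
  rw [ae_all_iff]
  intro k
  let A : ℕ → ℤ → Set Ω := fun n j => freshMax X (1 + j * N) n ∩ stayForever X (1 + j * N) n
  let E : Set Ω := ⋃ n, ⋃ (_ : k ≤ n), ⋃ j, A n j
  let 𝓖 := natFiltration hX.meas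
  have hXsup : ∀ n, Measurable[⨆ n, 𝓖 n] (X n) := fun n =>
    (measurable_natSA le_rfl).mono (le_iSup (fun n => 𝓖 n) n) le_rfl
  have hAE : ∀ n j, MeasurableSet[⨆ n, 𝓖 n] (A n j) := fun n j => by
    refine .inter (le_iSup (fun n => 𝓖 n) n _ (measurableSet_freshMax X _ n)) ?_
    have : stayForever X (1 + j * N) n = ⋂ i, X (n + i) ⁻¹' Set.Ici (1 + j * N : ℤ) := by
      ext ω; simp [stayForever]
    rw [this]
    exact .iInter fun i => hXsup _ (.of_discrete (s := Set.Ici (1 + j * N : ℤ)))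
  have hE : MeasurableSet[⨆ n, 𝓖 n] E :=
    .iUnion fun n => .iUnion fun _ => .iUnion fun j => hAE n j
  have hsup : (⨆ n, 𝓖 n) ≤ ‹MeasurableSpace Ω› := iSup_le fun n => 𝓖.le n
  have hEi : Integrable (E.indicator fun _ => (1 : ℝ)) P :=
    (integrable_const 1).indicator (hsup _ hE)
  have hlevy := tendsto_ae_condExp (μ := P) (ℱ := 𝓖) (E.indicator fun _ => (1 : ℝ))
  rw [condExp_of_stronglyMeasurable hsup (stronglyMeasurable_const.indicator hE) hEi] at hlevy
  have hlow : ∀ᵐ ω ∂P, ∀ n ≥ k, ∀ j : ℤ, ω ∈ freshMax X (1 + j * N) n →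
      q ≤ P[E.indicator (fun _ => (1 : ℝ)) | 𝓖 n] ω := by
    simp only [ae_all_iff]
    intro n hn j
    have hmono : P[(A n j).indicator (fun _ => (1 : ℝ)) | 𝓖 n]
        ≤ᵐ[P] P[E.indicator (fun _ => (1 : ℝ)) | 𝓖 n] := by
      refine condExp_mono ((integrable_const 1).indicator (hsup _ (hAE n j))) hEi
        (.of_forall fun ω => Set.indicator_le_indicator_of_subset ?_ (fun _ => zero_le_one) ω)
      exact fun ω hω => Set.mem_iUnion.2 ⟨n, Set.mem_iUnion.2 ⟨hn, Set.mem_iUnion.2 ⟨j, hω⟩⟩⟩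
    filter_upwards [hmono, hX.condExp_freshMax_stayForever (1 + j * N) n (hq j)] with ω h₁ h₂ hω
    rw [Set.indicator_of_mem hω] at h₂
    exact h₂.symm.le.trans h₁
  filter_upwards [hlevy, hlow, hX.ae_exists_le h0, hX.ae_right_or_left] with ω hω hlo hunb hstep
  have hfreq : ∃ᶠ n in atTop, q ≤ P[E.indicator (fun _ => (1 : ℝ)) | 𝓖 n] ω := by
    rw [frequently_atTop]
    intro k'
    obtain ⟨M, hM⟩ : ∃ M, ∀ m ≤ max k k', X m ω < M := by
      obtain ⟨M, hM⟩ := ((Set.finite_Iic (max k k')).image fun m => X m ω).bddAbove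
      exact ⟨M + 1, fun m hm => Int.lt_add_one_of_le (hM ⟨m, hm, rfl⟩)⟩
    have hlevel : M ≤ 1 + |M| * N := by
      have h₁ : (1 : ℤ) ≤ N := by exact_mod_cast hN
      nlinarith [le_abs_self M, abs_nonneg M]
    obtain ⟨n, hn, hlt⟩ := exists_first_eq (u := fun n => X n ω)
      (fun n => by rcases hstep n with h | h <;> omega) hunb
      ((hM 0 (Nat.zero_le _)).trans_le hlevel)
    have hkn : max k k' < n := by
      by_contra! h
      exact absurd (hM n h) (not_lt.2 (hlevel.trans hn.ge))
    exact ⟨n, (le_max_right _ _).trans hkn.le,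
      hlo n ((le_max_left _ _).trans hkn.le) |M| ⟨hn, hlt⟩⟩
  have hmem : ω ∈ E := by
    by_contra h
    rw [Set.indicator_of_notMem h] at hω
    exact hfreq ((hω.eventually_lt_const hq0).mono fun _ => not_le.2)
  simpa [E, A] using hmem

/-- If the walk started at `1` in a periodic environment never hits `0` with positive
probability, then any walk in the same environment, started anywhere, tends to `+∞` a.s. -/
theorem stmt1 (env : ℤ → ℝ) (henv : ∀ x : ℤ, env x ∈ Set.Ico (1 / 2 : ℝ) 1)
    (N : ℕ) (hN : 1 ≤ N) (hper : ∀ x : ℤ, env (x + N) = env x)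
    {Ω : Type*} [MeasurableSpace Ω] (P : Measure Ω) [IsProbabilityMeasure P]
    (X : ℕ → Ω → ℤ) (hX : IsCookieRW P env X) (hX0 : ∀ᵐ ω ∂P, X 0 ω = 1)
    (hhit : 0 < P {ω | hitTime X 0 ω = ⊤}) :
    ∀ {Ω' : Type*} [MeasurableSpace Ω'] (P' : Measure Ω') [IsProbabilityMeasure P']
      (Y : ℕ → Ω' → ℤ), IsCookieRW P' env Y →
      ∀ y : ℤ, (∀ᵐ ω ∂P', Y 0 ω = y) →
      ∀ᵐ ω ∂P', Tendsto (fun n => Y n ω) atTop atTop := by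
  intro Ω' _ P' _ Y hY y hY0
  have hq : ∀ j : ℤ, Tendsto (fun m => stayProb env (1 + j * N) m (1 + j * N) ∅) atTop
      (nhds (P.real (stayForever X 1 0))) := fun j => by
    simp only [stayProb_add 1 (j * N) (env_add_mul hper j) _ 1 ∅ ∅ (by simp)]
    exact hX.tendsto_stayProb hX0
  filter_upwards [hY.ae_frequently_freshMax_stayForever hY0 hN
    (hX.measure_stayForever_pos hX0 hhit) hq, hY.ae_exists_le hY0] with ω hω hunb
  rw [tendsto_atTop_atTop]
  intro M
  obtain ⟨k, hk⟩ := hunb M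
  obtain ⟨n, hn, j, hmax, hstay⟩ := hω (k + 1)
  refine ⟨n, fun i hi => ?_⟩
  have := hmax.2 k hn
  have := hstay (i - n)
  rw [Nat.add_sub_cancel' hi] at this
  omega
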